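/- arXiv:2112.13106 — 10 statements merged into one kernel-verified Lean document; each statement's English description precedes it below -/
import Mathlib

section
/- Let (X, 𝓤) be a uniform space and suppose X = ⋃_{n ∈ ℕ} X_n. Then (X, 𝓤) is Menger-bounded if and only if for each n ∈ ℕ the subspace X_n (with the relative uniformity) is Menger-bounded. -/
open UniformSpace Set Filter Uniformity

def MengerBounded (X : Type*) [UniformSpace X] : Prop :=
  ∀ U : ℕ → Set (X × X), (∀ n, U n ∈ 𝓤 X) →
    ∃ F : ℕ → Finset X, ∀ x : X, ∃ n : ℕ, ∃ y ∈ F n, x ∈ UniformSpace.ball y (U n)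

/-- Menger-boundedness pulls back along uniform inducing maps. -/
theorem MengerBounded.of_isUniformInducing {X Y : Type*} [UniformSpace X] [UniformSpace Y]
    {f : Y → X} (hf : IsUniformInducing f) (hX : MengerBounded X) : MengerBounded Y := by
  classical
  intro U hU
  have hV (n : ℕ) : ∃ V ∈ 𝓤 X, ∀ (x : X) (a b : Y),
      (x, f a) ∈ V → (x, f b) ∈ V → (a, b) ∈ U n := by
    have hUn := hU n
    rw [← hf.comap_uniformity] at hUn
    obtain ⟨W, hW, hWU⟩ := hUn
    obtain ⟨V, hV, hVsymm, hVW⟩ := comp_symm_mem_uniformity_sets hW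
    exact ⟨V, hV, fun x a b ha hb => hWU (hVW ⟨x, hVsymm.symm _ _ ha, hb⟩)⟩
  choose V hV hVU using hV
  obtain ⟨F, hF⟩ := hX V hV
  have hg (n : ℕ) (x : X) : ∃ s : Finset Y, ∀ b, (x, f b) ∈ V n →
      ∃ a ∈ s, (a, b) ∈ U n := by
    by_cases h : ∃ a, (x, f a) ∈ V n
    · obtain ⟨a, ha⟩ := h
      exact ⟨{a}, fun b hb => ⟨a, Finset.mem_singleton_self a, hVU n x a b ha hb⟩⟩
    · exact ⟨∅, fun b hb => absurd ⟨b, hb⟩ h⟩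
  choose g hg using hg
  refine ⟨fun n => (F n).biUnion (g n), fun b => ?_⟩
  obtain ⟨n, x, hx, hxb⟩ := hF (f b)
  obtain ⟨a, ha, hab⟩ := hg n x b hxb
  exact ⟨n, a, Finset.mem_biUnion.2 ⟨x, hx, ha⟩, hab⟩

/-- A countable union of Menger-bounded subspaces is Menger-bounded. -/
theorem MengerBounded.of_iUnion_eq_univ {X : Type*} [UniformSpace X] {Xn : ℕ → Set X}
    (hX : (⋃ n, Xn n) = Set.univ) (h : ∀ n, MengerBounded ↥(Xn n)) : MengerBounded X := by
  intro U hU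
  choose F hF using fun n => h n
    (fun m => Prod.map Subtype.val Subtype.val ⁻¹' U (Nat.pair n m))
    (fun m => uniformContinuous_subtype_val (hU (Nat.pair n m)))
  refine ⟨fun k => (F k.unpair.1 k.unpair.2).map (Function.Embedding.subtype _), fun x => ?_⟩
  obtain ⟨n, hn⟩ := mem_iUnion.1 (hX ▸ mem_univ x)
  obtain ⟨m, y, hy, hxy⟩ := hF n ⟨x, hn⟩
  refine ⟨Nat.pair n m, y, Finset.mem_map.2 ?_, hxy⟩
  rw [Nat.unpair_pair]
  exact ⟨y, hy, rfl⟩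

theorem stmt_0 {X : Type*} [UniformSpace X] (Xn : ℕ → Set X)
    (hX : (⋃ n, Xn n) = Set.univ) :
    MengerBounded X ↔ ∀ n : ℕ, MengerBounded ↥(Xn n) :=
  ⟨fun h _ => h.of_isUniformInducing isUniformEmbedding_subtype_val.isUniformInducing,
    MengerBounded.of_iUnion_eq_univ hX⟩
end

section
/- Let (X, 𝓤) be a pre-Lindelöf uniform space such that every X-indexed family of functions ℕ → ℕ is non-dominating, i.e., for every family (f_x)_{x ∈ X} of functions ℕ → ℕ there exists g : ℕ → ℕ such that for every x ∈ X the set {n ∈ ℕ : f_x(n) < g(n)} is infinite (this holds precisely when |X| < 𝔡, the dominating number). Then (X, 𝓤) is Menger-bounded. -/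
open UniformSpace Set Filter Uniformity

def PreLindelof (X : Type*) [UniformSpace X] : Prop :=
  ∀ U ∈ 𝓤 X, ∃ A : Set X, A.Countable ∧ (⋃ x ∈ A, UniformSpace.ball x U) = Set.univ

theorem stmt_3 {X : Type*} [UniformSpace X] (hpL : PreLindelof X)
    (hsmall : ∀ f : X → ℕ → ℕ, ∃ g : ℕ → ℕ, ∀ x : X, {n : ℕ | f x n < g n}.Infinite) :
    MengerBounded X := by
  intro U hU
  choose A hA hcover using fun n => hpL (U n) (hU n)
  choose e he using fun n => Set.countable_iff_exists_injOn.1 (hA n)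
  have hcenter (x : X) (n : ℕ) : ∃ a ∈ A n, x ∈ UniformSpace.ball a (U n) := by
    simpa using (hcover n).ge (Set.mem_univ x)
  choose a ha hxa using hcenter
  obtain ⟨g, hg⟩ := hsmall fun x n => e n (a x n)
  have hfin (n : ℕ) : {y ∈ A n | e n y < g n}.Finite :=
    Set.Finite.of_injOn (t := Set.Iio (g n)) (fun _ hy => hy.2)
      ((he n).mono fun _ hy => hy.1) (Set.finite_Iio _)
  refine ⟨fun n => (hfin n).toFinset, fun x => ?_⟩
  obtain ⟨n, hn⟩ := (hg x).nonempty
  exact ⟨n, a x n, (hfin n).mem_toFinset.2 ⟨ha x n, hn⟩, hxa x n⟩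
end

section
/- Let (X, 𝓤) be a pre-Lindelöf uniform space such that every X-indexed family of functions ℕ → ℕ is bounded with respect to eventual dominance, i.e., for every family (f_x)_{x ∈ X} of functions ℕ → ℕ there exists g : ℕ → ℕ such that for every x ∈ X one has f_x(n) ≤ g(n) for all but finitely many n (this holds precisely when |X| < 𝔟, the bounding number). Then (X, 𝓤) is Hurewicz-bounded. -/
open UniformSpace Set Filter Uniformity

def HurewiczBounded (X : Type*) [UniformSpace X] : Prop :=
  ∀ U : ℕ → Set (X × X), (∀ n, U n ∈ 𝓤 X) →
    ∃ F : ℕ → Finset X, ∀ x : X,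
      ∀ᶠ n in Filter.atTop, ∃ y ∈ F n, x ∈ UniformSpace.ball y (U n)

theorem stmt_4 {X : Type*} [UniformSpace X] (hpL : PreLindelof X)
    (hsmall : ∀ f : X → ℕ → ℕ, ∃ g : ℕ → ℕ, ∀ x : X,
      ∀ᶠ n in Filter.atTop, f x n ≤ g n) :
    HurewiczBounded X := by
  intro U hU
  choose A hA hcover using fun n => hpL (U n) (hU n)
  choose e he using fun n => Set.countable_iff_exists_injOn.mp (hA n)
  have hmem : ∀ (x : X) (n : ℕ), ∃ y ∈ A n, x ∈ UniformSpace.ball y (U n) := fun x n => by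
    have hx : x ∈ ⋃ y ∈ A n, UniformSpace.ball y (U n) := hcover n ▸ Set.mem_univ x
    simpa only [Set.mem_iUnion, exists_prop] using hx
  choose c hcA hcU using hmem
  obtain ⟨g, hg⟩ := hsmall fun x n => e n (c x n)
  have hfin : ∀ n, {y ∈ A n | e n y ≤ g n}.Finite := fun n =>
    Set.Finite.of_finite_image ((Set.finite_Iic (g n)).subset (by rintro _ ⟨y, hy, rfl⟩; exact hy.2))
      ((he n).mono fun _ hy => hy.1)
  refine ⟨fun n => (hfin n).toFinset, fun x => ?_⟩
  filter_upwards [hg x] with n hn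
  exact ⟨c x n, (hfin n).mem_toFinset.mpr ⟨hcA x n, hn⟩, hcU x n⟩
end

section
/- If (X, 𝓤) is a Menger-bounded uniform space and f : X → ℕ^ℕ is a uniformly continuous map into the Baire space, then the image f(X) is not dominating: there exists g ∈ ℕ^ℕ such that for every x ∈ X the set {n ∈ ℕ : f(x)(n) < g(n)} is infinite. -/
open UniformSpace Set Filter Uniformity

theorem UniformContinuous.setOf_apply_eq_mem_uniformity {X : Type*} [UniformSpace X]
    {f : X → ℕ → ℕ} (hf : UniformContinuous f) (n : ℕ) :
    {p : X × X | f p.1 n = f p.2 n} ∈ 𝓤 X := by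
  have hn : UniformContinuous fun x => f x n := uniformContinuous_pi.mp hf n
  have hdiag : SetRel.id ∈ 𝓤 ℕ := by simp [DiscreteUniformity.eq_principal_setRelId]
  exact hn hdiag

theorem stmt_6 {X : Type*} [UniformSpace X] (hX : MengerBounded X)
    (f : X → (ℕ → ℕ)) (hf : UniformContinuous f) :
    ∃ g : ℕ → ℕ, ∀ x : X, {n : ℕ | f x n < g n}.Infinite := by
  choose F hF using fun m : ℕ =>
    hX (fun k => {p | f p.1 (m + k) = f p.2 (m + k)})
      fun k => hf.setOf_apply_eq_mem_uniformity (m + k)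
  refine ⟨fun n => (∑ m ∈ Finset.range (n + 1), ∑ y ∈ F m (n - m), f y n) + 1, fun x => ?_⟩
  rw [← Nat.frequently_atTop_iff_infinite, frequently_atTop]
  intro m
  obtain ⟨k, y, hy, hxy⟩ := hF m x
  replace hxy : f y (m + k) = f x (m + k) := hxy
  refine ⟨m + k, Nat.le_add_right m k, Nat.lt_succ_of_le ?_⟩
  calc
    f x (m + k) = f y (m + k) := hxy.symm
    _ ≤ ∑ y ∈ F m (m + k - m), f y (m + k) :=
      Finset.single_le_sum (f := fun y => f y (m + k)) (fun _ _ => Nat.zero_le _) (by simpa using hy)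
    _ ≤ ∑ i ∈ Finset.range (m + k + 1), ∑ y ∈ F i (m + k - i), f y (m + k) :=
      Finset.single_le_sum (f := fun i => ∑ y ∈ F i (m + k - i), f y (m + k))
        (fun _ _ => Nat.zero_le _) (Finset.mem_range.mpr (by omega))
end

section
/- If (X, 𝓤) is a Hurewicz-bounded uniform space and f : X → ℕ^ℕ is a uniformly continuous map into the Baire space, then the image f(X) is bounded with respect to eventual dominance: there exists g ∈ ℕ^ℕ such that for every x ∈ X one has f(x)(n) ≤ g(n) for all but finitely many n. -/
open UniformSpace Set Filter Uniformity

theorem stmt_7 {X : Type*} [UniformSpace X] (hX : HurewiczBounded X)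
    (f : X → (ℕ → ℕ)) (hf : UniformContinuous f) :
    ∃ g : ℕ → ℕ, ∀ x : X, ∀ᶠ n in Filter.atTop, f x n ≤ g n := by
  have hU : ∀ n, {p : X × X | f p.1 n = f p.2 n} ∈ 𝓤 X := fun n => by
    filter_upwards [uniformContinuous_pi.1 hf n (Metric.dist_mem_uniformity one_pos)] with p hp
    by_contra hne
    exact (Nat.pairwise_one_le_dist hne).not_gt hp
  obtain ⟨F, hF⟩ := hX _ hU
  refine ⟨fun n => (F n).sup fun y => f y n, fun x => (hF x).mono ?_⟩
  rintro n ⟨y, hy, hxy⟩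
  have hval : f y n = f x n := hxy
  exact hval ▸ Finset.le_sup (f := fun y => f y n) hy
end

section
/- If (X, 𝓤) is a Rothberger-bounded uniform space and f : X → ℕ^ℕ is a uniformly continuous map into the Baire space, then the image f(X) can be guessed: there exists g ∈ ℕ^ℕ such that for every x ∈ X the set {n ∈ ℕ : f(x)(n) = g(n)} is infinite. -/
open UniformSpace Set Filter Uniformity

def RothbergerBounded (X : Type*) [UniformSpace X] : Prop :=
  ∀ U : ℕ → Set (X × X), (∀ n, U n ∈ 𝓤 X) →
    ∃ c : ℕ → X, ∀ x : X, ∃ n : ℕ, x ∈ UniformSpace.ball (c n) (U n)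

theorem setOf_apply_eq_apply_mem_uniformity {X : Type*} [UniformSpace X]
    {f : X → (ℕ → ℕ)} (hf : UniformContinuous f) (n : ℕ) :
    {p : X × X | f p.1 n = f p.2 n} ∈ 𝓤 X := by
  have h := (uniformContinuous_pi.mp hf n) (DiscreteUniformity.relId_mem_uniformity ℕ)
  filter_upwards [h] with p hp using hp

theorem stmt_8 {X : Type*} [UniformSpace X] (hX : RothbergerBounded X)
    (f : X → (ℕ → ℕ)) (hf : UniformContinuous f) :
    ∃ g : ℕ → ℕ, ∀ x : X, {n : ℕ | f x n = g n}.Infinite := by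
  choose c hc using fun k : ℕ =>
    hX _ fun m => setOf_apply_eq_apply_mem_uniformity hf (Nat.pair k m)
  refine ⟨fun n => f (c n.unpair.1 n.unpair.2) n, fun x => ?_⟩
  refine Set.infinite_of_forall_exists_gt fun k => ?_
  obtain ⟨m, hm⟩ := hc (k + 1) x
  have hm : f (c (k + 1) m) (Nat.pair (k + 1) m) = f x (Nat.pair (k + 1) m) := hm
  exact ⟨Nat.pair (k + 1) m, by simp [hm], Nat.left_le_pair (k + 1) m⟩
end

section
/- Let (X, 𝓤) be a uniform space whose induced topological space is Lindelöf. Then (X, 𝓤) is Menger-bounded if and only if (X, 𝓤) is locally Menger-bounded. -/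
open UniformSpace Set Filter Uniformity

def LocallyMengerBounded (X : Type*) [UniformSpace X] : Prop :=
  ∀ x : X, ∃ U ∈ 𝓤 X, MengerBounded ↥(UniformSpace.ball x U)

/-- A uniformly continuous image of a Menger-bounded space is Menger-bounded. -/
theorem MengerBounded.of_surjective {X Y : Type*} [UniformSpace X] [UniformSpace Y]
    (h : MengerBounded X) {f : X → Y} (hf : UniformContinuous f) (hs : Function.Surjective f) :
    MengerBounded Y := by
  classical
  intro U hU
  obtain ⟨F, hF⟩ := h (fun n => Prod.map f f ⁻¹' U n) fun n => hf (hU n)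
  refine ⟨fun n => (F n).image f, fun y => ?_⟩
  obtain ⟨x, rfl⟩ := hs y
  obtain ⟨n, z, hz, hx⟩ := hF x
  exact ⟨n, f z, Finset.mem_image_of_mem f hz, hx⟩

/-- A space covered by countably many Menger-bounded subspaces is Menger-bounded. -/
theorem MengerBounded.of_iUnion_eq_univ_s10 {X : Type*} [UniformSpace X] {s : ℕ → Set X}
    (hs : ∀ k, MengerBounded (s k)) (hcover : ⋃ k, s k = univ) : MengerBounded X := by
  classical
  intro U hU
  choose F hF using fun k => hs k
    (fun m => Prod.map Subtype.val Subtype.val ⁻¹' U (Nat.pair k m))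
    fun m => uniformContinuous_subtype_val (hU (Nat.pair k m))
  let G : ℕ × ℕ → Finset X := fun p => (F p.1 p.2).image Subtype.val
  refine ⟨fun n => G n.unpair, fun x => ?_⟩
  obtain ⟨k, hk⟩ := mem_iUnion.1 (hcover.symm ▸ mem_univ x)
  obtain ⟨m, z, hz, hx⟩ := hF k ⟨x, hk⟩
  refine ⟨Nat.pair k m, z, ?_, hx⟩
  change z.1 ∈ G (Nat.pair k m).unpair
  rw [Nat.unpair_pair]
  exact Finset.mem_image_of_mem _ hz

theorem stmt_10 {X : Type*} [UniformSpace X] [LindelofSpace X] :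
    MengerBounded X ↔ LocallyMengerBounded X := by
  constructor
  · intro h x
    refine ⟨univ, univ_mem, h.of_surjective (f := fun y => ⟨y, mem_univ _⟩) ?_ ?_⟩
    · exact uniformContinuous_id.subtype_mk _
    · exact fun y => ⟨y, rfl⟩
  · intro h
    choose U hU hM using h
    obtain ⟨t, ht, hcover⟩ := LindelofSpace.elim_nhds_subcover
      (fun x => ball x (U x)) fun x => ball_mem_nhds x (hU x)
    rcases t.eq_empty_or_nonempty with rfl | hne
    · intro V _
      refine ⟨fun _ => ∅, fun x => ?_⟩
      have hx : x ∈ ⋃ y ∈ (∅ : Set X), ball y (U y) := hcover.symm ▸ mem_univ x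
      simp at hx
    · obtain ⟨f, rfl⟩ := ht.exists_eq_range hne
      rw [biUnion_range] at hcover
      exact MengerBounded.of_iUnion_eq_univ_s10 (fun k => hM (f k)) hcover
end

section
/- If f : (X, 𝓤) → (Y, 𝓥) is a uniformly continuous bi-quotient mapping from a locally Menger-bounded uniform space X onto a uniform space Y, then Y is locally Menger-bounded. -/
open UniformSpace Set Filter Uniformity

def BiQuotientMap {X Y : Type*} [TopologicalSpace X] [TopologicalSpace Y]
    (f : X → Y) : Prop :=
  Function.Surjective f ∧ Continuous f ∧
    ∀ y : Y, ∀ 𝒰 : Set (Set X), (∀ U ∈ 𝒰, IsOpen U) → f ⁻¹' {y} ⊆ ⋃₀ 𝒰 →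
      ∃ 𝒱 ⊆ 𝒰, 𝒱.Finite ∧ ∃ V : Set Y, IsOpen V ∧ y ∈ V ∧ V ⊆ ⋃ U ∈ 𝒱, f '' U

/-- A subset of a uniform space is Menger-bounded relative to the ambient space: the finite sets of
centres may be taken anywhere in the space. -/
def MengerBoundedIn {X : Type*} [UniformSpace X] (S : Set X) : Prop :=
  ∀ U : ℕ → Set (X × X), (∀ n, U n ∈ 𝓤 X) →
    ∃ F : ℕ → Finset X, ∀ x ∈ S, ∃ n : ℕ, ∃ y ∈ F n, x ∈ UniformSpace.ball y (U n)

namespace MengerBoundedIn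

variable {X Y : Type*} [UniformSpace X] [UniformSpace Y] {S T : Set X}

theorem of_mengerBounded (h : MengerBounded S) : MengerBoundedIn S := by
  classical
  intro U hU
  obtain ⟨F, hF⟩ := h (fun n => (fun p : S × S => ((p.1 : X), (p.2 : X))) ⁻¹' U n) fun n => by
    rw [uniformity_subtype]
    exact preimage_mem_comap (hU n)
  refine ⟨fun n => (F n).image Subtype.val, fun x hx => ?_⟩
  obtain ⟨n, y, hy, hxy⟩ := hF ⟨x, hx⟩
  exact ⟨n, y, Finset.mem_image_of_mem _ hy, hxy⟩

theorem mengerBounded (h : MengerBoundedIn S) : MengerBounded S := by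
  classical
  rcases isEmpty_or_nonempty S with hS | hS
  · exact fun U _ => ⟨fun _ => ∅, fun x => hS.elim x⟩
  intro U hU
  have hB : ∀ n, ∃ B ∈ 𝓤 X, (∀ {a b}, (a, b) ∈ B → (b, a) ∈ B) ∧
      ∀ a b c, (a, b) ∈ B → (b, c) ∈ B →
        ∀ (ha : a ∈ S) (hc : c ∈ S), ((⟨a, ha⟩ : S), (⟨c, hc⟩ : S)) ∈ U n := by
    intro n
    have hUn := hU n
    rw [uniformity_subtype] at hUn
    obtain ⟨A, hA, hAU⟩ := hUn
    obtain ⟨B, hB, hsymm, hBA⟩ := comp_symm_of_uniformity hA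
    exact ⟨B, hB, hsymm, fun a b c hab hbc ha hc => hAU (hBA ⟨b, hab, hbc⟩)⟩
  choose B hB hsymm hcomp using hB
  obtain ⟨F, hF⟩ := h B hB
  refine ⟨fun n => (F n).image fun y => Classical.epsilon fun s : S => (y, (s : X)) ∈ B n,
    fun x => ?_⟩
  obtain ⟨n, y, hy, hxy⟩ := hF x x.2
  refine ⟨n, _, Finset.mem_image_of_mem _ hy, ?_⟩
  have hs := Classical.epsilon_spec (p := fun s : S => (y, (s : X)) ∈ B n) ⟨x, hxy⟩
  exact hcomp n _ _ _ (hsymm n hs) hxy (Subtype.coe_prop _) x.2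

theorem mono (h : MengerBoundedIn T) (hST : S ⊆ T) : MengerBoundedIn S := fun U hU =>
  (h U hU).imp fun _ hF x hx => hF x (hST hx)

theorem empty : MengerBoundedIn (∅ : Set X) := fun _ _ => ⟨fun _ => ∅, fun _ hx => hx.elim⟩

theorem union (hS : MengerBoundedIn S) (hT : MengerBoundedIn T) : MengerBoundedIn (S ∪ T) := by
  classical
  intro U hU
  obtain ⟨F, hF⟩ := hS U hU
  obtain ⟨G, hG⟩ := hT U hU
  refine ⟨fun n => F n ∪ G n, ?_⟩
  rintro x (hx | hx)
  · obtain ⟨n, y, hy, hxy⟩ := hF x hx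
    exact ⟨n, y, Finset.mem_union_left _ hy, hxy⟩
  · obtain ⟨n, y, hy, hxy⟩ := hG x hx
    exact ⟨n, y, Finset.mem_union_right _ hy, hxy⟩

theorem biUnion {ι : Type*} {I : Set ι} (hI : I.Finite) {s : ι → Set X}
    (h : ∀ i ∈ I, MengerBoundedIn (s i)) : MengerBoundedIn (⋃ i ∈ I, s i) := by
  induction I, hI using Set.Finite.induction_on with
  | empty => simpa using empty
  | insert _ _ ih =>
    rw [biUnion_insert]
    exact (h _ (mem_insert _ _)).union (ih fun i hi => h i (mem_insert_of_mem _ hi))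

theorem image (h : MengerBoundedIn S) {f : X → Y} (hf : UniformContinuous f) :
    MengerBoundedIn (f '' S) := by
  classical
  intro U hU
  obtain ⟨F, hF⟩ := h _ fun n => hf (hU n)
  refine ⟨fun n => (F n).image f, ?_⟩
  rintro _ ⟨x, hx, rfl⟩
  obtain ⟨n, y, hy, hxy⟩ := hF x hx
  exact ⟨n, f y, Finset.mem_image_of_mem _ hy, hxy⟩

end MengerBoundedIn

theorem stmt_15 {X Y : Type*} [UniformSpace X] [UniformSpace Y] (f : X → Y)
    (hf : UniformContinuous f) (hbq : BiQuotientMap f)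
    (hX : LocallyMengerBounded X) : LocallyMengerBounded Y := by
  intro y
  obtain ⟨𝒱, h𝒱, hfin, V, hVo, hyV, hV⟩ := hbq.2.2 y {U | IsOpen U ∧ MengerBoundedIn U}
    (fun U hU => hU.1) fun x _ => by
      obtain ⟨U, hU, hUM⟩ := hX x
      exact ⟨interior (ball x U),
        ⟨isOpen_interior, (MengerBoundedIn.of_mengerBounded hUM).mono interior_subset⟩,
        mem_interior_iff_mem_nhds.2 (ball_mem_nhds x hU)⟩
  obtain ⟨W, hW, hWV⟩ := UniformSpace.mem_nhds_iff.1 (hVo.mem_nhds hyV)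
  exact ⟨W, hW, ((MengerBoundedIn.biUnion hfin fun U hU => (h𝒱 hU).2.image hf).mono
    (hWV.trans hV)).mengerBounded⟩
end

section
/- If f : (X, 𝓤) → (Y, 𝓥) is a uniformly continuous weakly perfect mapping from a locally Menger-bounded uniform space X onto a uniform space Y, then Y is locally Menger-bounded. -/
open UniformSpace Set Filter Uniformity

def WeaklyPerfectMap {X Y : Type*} [TopologicalSpace X] [TopologicalSpace Y]
    (f : X → Y) : Prop :=
  Function.Surjective f ∧ Continuous f ∧ IsClosedMap f ∧
    ∀ y : Y, IsLindelof (f ⁻¹' {y})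

theorem MengerBounded.of_subset_iUnion_range {Y : Type*} [UniformSpace Y] {Z : ℕ → Type*}
    [∀ i, UniformSpace (Z i)] (hZ : ∀ i, MengerBounded (Z i)) {g : ∀ i, Z i → Y}
    (hg : ∀ i, UniformContinuous (g i)) {S : Set Y} (hS : S ⊆ ⋃ i, range (g i)) :
    MengerBounded S := by
  classical
  intro U hU
  have hW : ∀ n, ∃ W ∈ 𝓤 Y, ∀ a b : S, ∀ y : Y, (y, (a : Y)) ∈ W → (y, (b : Y)) ∈ W →
      (a, b) ∈ U n := by
    intro n
    have hn := hU n
    rw [uniformity_subtype, mem_comap] at hn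
    obtain ⟨V, hV, hVU⟩ := hn
    obtain ⟨W, hW, hWsymm, hWV⟩ := comp_symm_mem_uniformity_sets hV
    exact ⟨W, hW, fun a b y ha hb ↦ hVU (hWV ⟨y, hWsymm.symm _ _ ha, hb⟩)⟩
  choose W hW hWU using hW
  choose F hF using fun i ↦ hZ i (fun n ↦ Prod.map (g i) (g i) ⁻¹' W (Nat.pair i n))
    fun n ↦ hg i (hW _)
  rcases S.eq_empty_or_nonempty with rfl | ⟨s₀, hs₀⟩
  · exact ⟨fun _ ↦ ∅, fun x ↦ x.2.elim⟩
  have hpick : ∀ (n : ℕ) (y : Y), ∃ s : S, ∀ t : S, (y, (t : Y)) ∈ W n → (y, (s : Y)) ∈ W n := by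
    intro n y
    by_cases h : ∃ t : S, (y, (t : Y)) ∈ W n
    · obtain ⟨t, ht⟩ := h
      exact ⟨t, fun _ _ ↦ ht⟩
    · exact ⟨⟨s₀, hs₀⟩, fun t ht ↦ (h ⟨t, ht⟩).elim⟩
  choose pick hpick using hpick
  refine ⟨fun m ↦ (F m.unpair.1 m.unpair.2).image fun z ↦ pick m (g _ z), fun s ↦ ?_⟩
  obtain ⟨i, x, hx⟩ := mem_iUnion.1 (hS s.2)
  obtain ⟨n, z, hz, hxz⟩ := hF i x
  have hzs : (g i z, (s : Y)) ∈ W (Nat.pair i n) := hx ▸ hxz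
  refine ⟨Nat.pair i n, pick (Nat.pair i n) (g i z), ?_, hWU _ _ _ _ (hpick _ _ s hzs) hzs⟩
  rw [Finset.mem_image]
  generalize hm : Nat.pair i n = m
  obtain rfl : m.unpair.1 = i := by rw [← hm, Nat.unpair_pair]
  obtain rfl : m.unpair.2 = n := by rw [← hm, Nat.unpair_pair]
  exact ⟨z, hz, rfl⟩

theorem stmt_16 {X Y : Type*} [UniformSpace X] [UniformSpace Y] (f : X → Y)
    (hf : UniformContinuous f) (hwp : WeaklyPerfectMap f)
    (hX : LocallyMengerBounded X) : LocallyMengerBounded Y := by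
  obtain ⟨hsurj, -, hclosed, hlin⟩ := hwp
  choose U hU hUM using hX
  intro y
  obtain ⟨t, ht, -, hcover⟩ := (hlin y).elim_nhds_subcover
    (fun x ↦ interior (UniformSpace.ball x (U x)))
    fun x _ ↦ interior_mem_nhds.2 (ball_mem_nhds x (hU x))
  have htne : t.Nonempty := by
    obtain ⟨x, hx⟩ := hsurj y
    obtain ⟨z, hz, -⟩ := mem_iUnion₂.1 (hcover hx)
    exact ⟨z, hz⟩
  obtain ⟨e, rfl⟩ := ht.exists_eq_range htne
  have hO : IsOpen (⋃ x ∈ range e, interior (UniformSpace.ball x (U x))) :=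
    isOpen_biUnion fun _ _ ↦ isOpen_interior
  have hnhds : (f '' (⋃ x ∈ range e, interior (UniformSpace.ball x (U x)))ᶜ)ᶜ ∈ nhds y := by
    refine (hclosed _ hO.isClosed_compl).isOpen_compl.mem_nhds ?_
    rintro ⟨x, hx, hxy⟩
    exact hx (hcover hxy)
  obtain ⟨V, hV, hVsub⟩ := UniformSpace.mem_nhds_iff.1 hnhds
  refine ⟨V, hV, MengerBounded.of_subset_iUnion_range (fun i ↦ hUM (e i))
    (g := fun i x ↦ f x) (fun i ↦ hf.comp uniformContinuous_subtype_val) fun z hz ↦ ?_⟩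
  obtain ⟨x, rfl⟩ := hsurj z
  have hx : x ∈ ⋃ x ∈ range e, interior (UniformSpace.ball x (U x)) := by
    by_contra h
    exact hVsub hz ⟨x, h, rfl⟩
  rw [biUnion_range] at hx
  obtain ⟨i, hi⟩ := mem_iUnion.1 hx
  exact mem_iUnion.2 ⟨i, ⟨x, interior_subset hi⟩, rfl⟩
end

section
/- Let {X_α : α ∈ Λ} be a family of open subspaces of a uniform space (X, 𝓤) with X = ⋃_{α ∈ Λ} X_α. Then (X, 𝓤) is locally Menger-bounded if and only if each X_α (with the relative uniformity) is locally Menger-bounded. -/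
open UniformSpace Set Filter Uniformity

theorem LocallyMengerBounded.subtype {X : Type*} [UniformSpace X] (h : LocallyMengerBounded X)
    (s : Set X) : LocallyMengerBounded ↥s := by
  rintro x
  obtain ⟨U, hU, hM⟩ := h x
  refine ⟨Prod.map Subtype.val Subtype.val ⁻¹' U, ?_, ?_⟩
  · exact uniformContinuous_subtype_val hU
  · let f : ↥(UniformSpace.ball x (Prod.map Subtype.val Subtype.val ⁻¹' U)) →
        ↥(UniformSpace.ball (x : X) U) := fun y => ⟨y.1.1, y.2⟩
    have hf : IsUniformInducing (Subtype.val ∘ f) :=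
      (isUniformInducing_val s).comp (isUniformInducing_val _)
    exact hM.of_isUniformInducing ((isUniformInducing_val _).of_comp_iff.1 hf)

theorem stmt_17 {X : Type*} [UniformSpace X] {Λ : Type*} (Xa : Λ → Set X)
    (hopen : ∀ α, IsOpen (Xa α)) (hX : (⋃ α, Xa α) = Set.univ) :
    LocallyMengerBounded X ↔ ∀ α, LocallyMengerBounded ↥(Xa α) := by
  refine ⟨fun h α => h.subtype (Xa α), fun h x => ?_⟩
  obtain ⟨α, hx⟩ := Set.mem_iUnion.1 (hX ▸ Set.mem_univ x)
  obtain ⟨V, hV, hM⟩ := h α ⟨x, hx⟩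
  rw [← (isUniformInducing_val (Xa α)).comap_uniformity] at hV
  obtain ⟨U, hU, hUV⟩ := hV
  obtain ⟨W, hW, hWX⟩ := UniformSpace.mem_nhds_iff.1 ((hopen α).mem_nhds hx)
  refine ⟨U ∩ W, Filter.inter_mem hU hW, ?_⟩
  let f : ↥(UniformSpace.ball x (U ∩ W)) → ↥(UniformSpace.ball (⟨x, hx⟩ : ↥(Xa α)) V) :=
    fun y => ⟨⟨y.1, hWX y.2.2⟩, hUV y.2.1⟩
  have hval := (isUniformInducing_val (Xa α)).comp
    (isUniformInducing_val (UniformSpace.ball (⟨x, hx⟩ : ↥(Xa α)) V))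
  have hf : IsUniformInducing ((Subtype.val ∘ Subtype.val) ∘ f) :=
    isUniformInducing_val (UniformSpace.ball x (U ∩ W))
  exact hM.of_isUniformInducing (hval.of_comp_iff.1 hf)
end
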